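/- In the single-variable DSD fitting problem with m ≥ 1, if (α*, β*, γ*) is a global minimizer of f over the feasible region {α ≥ 0, β ≥ 0, γ ∈ ℝ} with α* = 0 and β* = 0, then γ* = Ȳ and S_{rr} = S_{cc}; in fact S_{rr} = S_{cc} = 0. -/

import Mathlib

/-- A quadratic without constant term that is nonnegative on `[0, ∞)` has nonnegative slope at `0`. -/
theorem linear_coeff_nonneg_of_quadratic_nonneg {L K : ℝ}
    (h : ∀ t : ℝ, 0 ≤ t → 0 ≤ t * L + t ^ 2 * K) : 0 ≤ L := by
  by_contra! hL
  have hK : 0 < |K| + 1 := by positivity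
  have ht : 0 < -L / (|K| + 1) := div_pos (by linarith) hK
  have hmul : -L / (|K| + 1) * (|K| + 1) = -L := div_mul_cancel₀ _ hK.ne'
  have hq := h _ ht.le
  generalize -L / (|K| + 1) = t at *
  nlinarith [mul_le_mul_of_nonneg_left (le_abs_self K) (sq_nonneg t), pow_pos ht 2]

/-- Deviations from the mean sum to zero. -/
theorem sum_sub_mean_eq_zero {m : ℕ} (hm : 1 ≤ m) (y : Fin m → ℝ) {ybar : ℝ}
    (hy : ybar = (1 / (m : ℝ)) * ∑ j, y j) : ∑ j, (y j - ybar) = 0 := by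
  have hm0 : (m : ℝ) ≠ 0 := by positivity
  rw [Finset.sum_sub_distrib, hy]
  simp only [Finset.sum_const, Finset.card_univ, Fintype.card_fin, nsmul_eq_mul]
  field_simp
  ring

/-- Expansion of the DSD objective around `(0, 0, ybar)`, for any centre `ybar`. -/
theorem dsd_objective_expansion {m : ℕ} (cX rX cY rY : Fin m → ℝ) (ybar a b : ℝ) :
    ∑ j, ((cY j - (a - b) * cX j - ybar) ^ 2 + (1 / 3) * (rY j - (a + b) * rX j) ^ 2)
      = ∑ j, ((cY j - ybar) ^ 2 + (1 / 3) * rY j ^ 2)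
        - 2 * (a - b) * ∑ j, (cY j - ybar) * cX j
        - 2 * (a + b) * ((1 / 3) * ∑ j, rX j * rY j)
        + ((a - b) ^ 2 * ∑ j, cX j ^ 2 + (a + b) ^ 2 * ((1 / 3) * ∑ j, rX j ^ 2)) := by
  simp only [Finset.mul_sum, ← Finset.sum_add_distrib, ← Finset.sum_sub_distrib]
  exact Finset.sum_congr rfl fun j _ => by ring

/-- Single-variable DSD fitting with `m ≥ 1`: if `(α*, β*, γ*)` is a global
minimizer of `f` over `{α ≥ 0, β ≥ 0, γ ∈ ℝ}` with `α* = 0` and `β* = 0`,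
then `γ* = Ȳ` and `S_rr = S_cc`; in fact `S_rr = S_cc = 0`. -/
theorem dsd_single_minimizer_both_zero (m : ℕ) (hm : 1 ≤ m)
    (cX rX cY rY : Fin m → ℝ) (hrX : ∀ j, 0 ≤ rX j) (hrY : ∀ j, 0 ≤ rY j)
    (f : ℝ → ℝ → ℝ → ℝ)
    (hf : f = fun a b g => ∑ j, ((cY j - (a - b) * cX j - g) ^ 2
        + (1 / 3) * (rY j - (a + b) * rX j) ^ 2))
    (Xbar Ybar Scc Srr : ℝ)
    (hXbar : Xbar = (1 / (m : ℝ)) * ∑ j, cX j)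
    (hYbar : Ybar = (1 / (m : ℝ)) * ∑ j, cY j)
    (hScc : Scc = ∑ j, (cY j - Ybar) * (cX j - Xbar))
    (hSrr : Srr = (1 / 3) * ∑ j, rX j * rY j)
    (α β γ : ℝ) (hα : α = 0) (hβ : β = 0)
    (hmin : ∀ a b g : ℝ, 0 ≤ a → 0 ≤ b → f α β γ ≤ f a b g) :
    γ = Ybar ∧ Srr = Scc ∧ Srr = 0 ∧ Scc = 0 := by
  subst hα hβ hf
  have hmpos : (0 : ℝ) < m := by exact_mod_cast hm
  have hdev := sum_sub_mean_eq_zero hm cY hYbar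
  have hScc' : ∑ j, (cY j - Ybar) * cX j = Scc := by
    simp only [hScc, mul_sub, Finset.sum_sub_distrib, ← Finset.sum_mul, hdev]
    ring
  have hγ : γ = Ybar := by
    have h := hmin 0 0 Ybar le_rfl le_rfl
    have hshift : ∑ j, ((cY j - (0 - 0) * cX j - γ) ^ 2
          + (1 / 3) * (rY j - (0 + 0) * rX j) ^ 2)
        = ∑ j, ((cY j - (0 - 0) * cX j - Ybar) ^ 2 + (1 / 3) * (rY j - (0 + 0) * rX j) ^ 2)
          + 2 * (Ybar - γ) * ∑ j, (cY j - Ybar) + m * (Ybar - γ) ^ 2 := by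
      have hconst : (m : ℝ) * (Ybar - γ) ^ 2 = ∑ _j : Fin m, (Ybar - γ) ^ 2 := by simp
      rw [hconst, Finset.mul_sum, ← Finset.sum_add_distrib, ← Finset.sum_add_distrib]
      exact Finset.sum_congr rfl fun j _ => by ring
    simp only [hshift, hdev] at h
    have hsq : (Ybar - γ) ^ 2 ≤ 0 := by
      by_contra! hpos
      linarith [mul_pos hmpos hpos]
    linarith [pow_eq_zero_iff two_ne_zero |>.mp (le_antisymm hsq (sq_nonneg (Ybar - γ)))]
  subst hγ
  have hmin_centre := fun a b => hmin a b γ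
  simp only [dsd_objective_expansion, hScc', ← hSrr] at hmin_centre
  have hslope_a : 0 ≤ -2 * Scc - 2 * Srr :=
    linear_coeff_nonneg_of_quadratic_nonneg
      (K := ∑ j, cX j ^ 2 + (1 / 3) * ∑ j, rX j ^ 2) fun t ht => by
        linarith [hmin_centre t 0 ht le_rfl]
  have hslope_b : 0 ≤ 2 * Scc - 2 * Srr :=
    linear_coeff_nonneg_of_quadratic_nonneg
      (K := ∑ j, cX j ^ 2 + (1 / 3) * ∑ j, rX j ^ 2) fun t ht => by
        linarith [hmin_centre 0 t le_rfl ht]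
  have hSrr_nonneg : 0 ≤ Srr := by
    rw [hSrr]
    exact mul_nonneg (by norm_num)
      (Finset.sum_nonneg fun j _ => mul_nonneg (hrX j) (hrY j))
  refine ⟨rfl, ?_, ?_, ?_⟩ <;> linarith
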